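/- Let κ, μ, r̂ > 0 and r > 0. For m_d > 0 let s₁(r; m_d) = (2 m_d^{m_d}(1+κ)^μ μ^μ / (Γ(μ)(m_d+κμ)^{m_d})) (r^{2μ−1}/r̂^{2μ}) e^{−r²(1+κ)μ/r̂²} ₁F₁(m_d; μ; μ²κ(1+κ)r²/(r̂²(m_d+κμ))) denote the single shadowed κ-μ Type I (Nakagami-m dominant shadowing) PDF. Then lim_{m_d → ∞} s₁(r; m_d) = 2μ(1+κ)^{(μ+1)/2} r^μ κ^{−(μ−1)/2} e^{−κμ} r̂^{−(μ+1)} e^{−μ(1+κ)r²/r̂²} I_{μ−1}(2μ√(κ(1+κ)) r/r̂), i.e., the single shadowed κ-μ Type I PDF converges pointwise to the κ-μ PDF as the dominant-component shadowing parameter tends to infinity. -/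

import Mathlib

open MeasureTheory Set

/-- Pochhammer (rising factorial) symbol `(a)_n = Γ(a+n)/Γ(a)`. -/
noncomputable def poch (a : ℝ) (n : ℕ) : ℝ := Real.Gamma (a + n) / Real.Gamma a

/-- Beta function `B(x,y) = Γ(x)Γ(y)/Γ(x+y)`. -/
noncomputable def betaFn (x y : ℝ) : ℝ := Real.Gamma x * Real.Gamma y / Real.Gamma (x + y)

/-- Modified Bessel function of the first kind of real order ν. -/
noncomputable def besselI (ν x : ℝ) : ℝ :=
  ∑' k : ℕ, (x / 2) ^ (ν + 2 * (k : ℝ)) / ((k.factorial : ℝ) * Real.Gamma (ν + (k : ℝ) + 1))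

/-- Modified Bessel function of the second kind of real order ν. -/
noncomputable def besselK (ν x : ℝ) : ℝ :=
  ∫ t in Ioi (0 : ℝ), Real.exp (-x * Real.cosh t) * Real.cosh (ν * t)

/-- Confluent hypergeometric function ₁F₁(a;b;z). -/
noncomputable def hyp1F1 (a b z : ℝ) : ℝ :=
  ∑' n : ℕ, poch a n * z ^ n / (poch b n * (n.factorial : ℝ))

/-- Gauss hypergeometric function ₂F₁(a,b;c;z). -/
noncomputable def hyp2F1 (a b c z : ℝ) : ℝ :=
  ∑' n : ℕ, poch a n * poch b n * z ^ n / (poch c n * (n.factorial : ℝ))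

/-- Tricomi confluent hypergeometric function U(a,b,z). -/
noncomputable def tricomiU (a b z : ℝ) : ℝ :=
  (1 / Real.Gamma a) *
    ∫ t in Ioi (0 : ℝ), Real.exp (-z * t) * t ^ (a - 1) * (1 + t) ^ (b - a - 1)

/-- Regularized generalized hypergeometric function ₃F̃₁(a₁,a₂,a₃;b;z). -/
noncomputable def hyp3F1reg (a₁ a₂ a₃ b z : ℝ) : ℝ :=
  ∑' n : ℕ, poch a₁ n * poch a₂ n * poch a₃ n * z ^ n /
    (Real.Gamma (b + n) * (n.factorial : ℝ))

/-- Regularized generalized hypergeometric function ₂F̃₂(a,b;c,d;z). -/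
noncomputable def hyp2F2reg (a b c d z : ℝ) : ℝ :=
  ∑' n : ℕ, poch a n * poch b n * z ^ n /
    (Real.Gamma (c + n) * Real.Gamma (d + n) * (n.factorial : ℝ))

open Filter Topology

theorem poch_zero {a : ℝ} (ha : 0 < a) : poch a 0 = 1 := by
  simp [poch, (Real.Gamma_pos_of_pos ha).ne']

theorem poch_succ {a : ℝ} (ha : 0 < a) (n : ℕ) : poch a (n + 1) = poch a n * (a + n) := by
  have h : a + n ≠ 0 := by positivity
  rw [poch, poch, Nat.cast_succ, ← add_assoc, Real.Gamma_add_one h]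
  ring

theorem poch_pos {a : ℝ} (ha : 0 < a) (n : ℕ) : 0 < poch a n :=
  div_pos (Real.Gamma_pos_of_pos (by positivity)) (Real.Gamma_pos_of_pos ha)

theorem summable_pow_div_poch {b : ℝ} (hb : 0 < b) (y : ℝ) :
    Summable fun n : ℕ => y ^ n / poch b n := by
  rcases eq_or_ne y 0 with rfl | hy
  · exact summable_of_ne_finset_zero (s := {0}) fun n hn => by
      simp [zero_pow (by simpa using hn : n ≠ 0)]
  refine summable_of_ratio_test_tendsto_lt_one (l := 0) one_pos
    (Eventually.of_forall fun n => div_ne_zero (pow_ne_zero n hy) (poch_pos hb n).ne') ?_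
  have h : Tendsto (fun n : ℕ => |y| / (b + n)) atTop (𝓝 0) :=
    (tendsto_atTop_add_const_left _ b tendsto_natCast_atTop_atTop).const_div_atTop _
  refine h.congr fun n => ?_
  have hp := poch_pos hb n
  have hn : 0 < b + n := by positivity
  have hy' : 0 < |y| := abs_pos.mpr hy
  rw [poch_succ hb]
  simp only [Real.norm_eq_abs, abs_div, abs_mul, abs_pow, abs_of_pos hp, abs_of_pos hn]
  field_simp
  ring

theorem tendsto_poch_div_add_pow (c : ℝ) (n : ℕ) :
    Tendsto (fun a : ℝ => poch a n / (a + c) ^ n) atTop (𝓝 1) := by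
  induction n with
  | zero =>
    refine tendsto_const_nhds.congr' ?_
    filter_upwards [eventually_gt_atTop 0] with a ha
    simp [poch_zero ha]
  | succ n ih =>
    have h : Tendsto (fun a : ℝ => 1 + (n - c) / (a + c)) atTop (𝓝 (1 + 0)) :=
      ((tendsto_atTop_add_const_right _ c tendsto_id).const_div_atTop _).const_add 1
    have h2 := ih.mul h
    rw [add_zero, one_mul] at h2
    refine h2.congr' ?_
    filter_upwards [eventually_gt_atTop 0, eventually_gt_atTop (-c)] with a ha hac
    have hc : a + c ≠ 0 := by linarith
    rw [poch_succ ha, pow_succ]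
    field_simp
    ring

theorem poch_div_add_pow_le_factorial {a c : ℝ} (ha : 1 ≤ a) (hc : 0 ≤ c) (n : ℕ) :
    poch a n / (a + c) ^ n ≤ n.factorial := by
  have ha0 : 0 < a := by linarith
  rw [div_le_iff₀ (by positivity)]
  induction n with
  | zero => simp [poch_zero ha0]
  | succ n ih =>
    have h : a + n ≤ (n + 1) * (a + c) := by
      nlinarith [mul_nonneg (Nat.cast_nonneg (α := ℝ) n) (sub_nonneg.mpr ha),
        mul_nonneg (Nat.cast_nonneg (α := ℝ) n) hc]
    rw [poch_succ ha0, Nat.factorial_succ, pow_succ]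
    push_cast
    calc poch a n * (a + n)
        ≤ (n.factorial * (a + c) ^ n) * ((n + 1) * (a + c)) := by gcongr
      _ = _ := by ring

theorem tendsto_hyp1F1_div_add {b c : ℝ} (hb : 0 < b) (hc : 0 ≤ c) (y : ℝ) :
    Tendsto (fun a : ℝ => hyp1F1 a b (y / (a + c))) atTop
      (𝓝 (∑' n : ℕ, y ^ n / (poch b n * n.factorial))) := by
  have key (a : ℝ) (n : ℕ) : poch a n * (y / (a + c)) ^ n / (poch b n * n.factorial) =
      poch a n / (a + c) ^ n * (y ^ n / (poch b n * n.factorial)) := by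
    rw [div_pow]
    ring
  simp only [hyp1F1, key]
  refine tendsto_tsum_of_dominated_convergence (summable_pow_div_poch hb y).norm ?_ ?_
  · intro n
    simpa using (tendsto_poch_div_add_pow c n).mul_const (y ^ n / (poch b n * n.factorial))
  · filter_upwards [eventually_ge_atTop 1] with a ha n
    have ha0 : 0 < a := by linarith
    have h0 : 0 ≤ poch a n / (a + c) ^ n :=
      div_nonneg (poch_pos ha0 n).le (by positivity)
    calc ‖poch a n / (a + c) ^ n * (y ^ n / (poch b n * n.factorial))‖
        = poch a n / (a + c) ^ n * ‖y ^ n / (poch b n * n.factorial)‖ := by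
          rw [norm_mul, Real.norm_of_nonneg h0]
      _ ≤ n.factorial * ‖y ^ n / (poch b n * n.factorial)‖ := by
          gcongr
          exact poch_div_add_pow_le_factorial ha hc n
      _ = ‖y ^ n / poch b n‖ := by
          rw [← div_div, norm_div _ (n.factorial : ℝ), Real.norm_natCast]
          field_simp

theorem besselI_eq_rpow_mul_tsum {ν x : ℝ} (hν : 0 < ν + 1) (hx : 0 < x) :
    besselI ν x = (x / 2) ^ ν / Real.Gamma (ν + 1) *
      ∑' n : ℕ, ((x / 2) ^ 2) ^ n / (poch (ν + 1) n * n.factorial) := by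
  rw [besselI, ← tsum_mul_left]
  refine tsum_congr fun n => ?_
  have hG := (Real.Gamma_pos_of_pos hν).ne'
  rw [Real.rpow_add (by positivity), ← pow_mul, ← Real.rpow_natCast (x / 2) (2 * n), poch,
    add_right_comm ν]
  push_cast
  field_simp

theorem tendsto_rpow_div_add_rpow (c : ℝ) :
    Tendsto (fun x : ℝ => x ^ x / (x + c) ^ x) atTop (𝓝 (Real.exp (-c))) := by
  rw [Real.exp_neg]
  refine ((Real.tendsto_one_add_div_rpow_exp c).inv₀ (Real.exp_ne_zero c)).congr' ?_
  filter_upwards [eventually_gt_atTop 0, eventually_gt_atTop (-c)] with x hx hxc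
  have h : 0 < x + c := by linarith
  rw [one_add_div hx.ne', Real.div_rpow h.le hx.le, inv_div]

theorem kappa_mu_coefficient_eq {k s m p r : ℝ} (hk : 0 < k) (hs : 0 < s) (hm : 0 < m)
    (hp : 0 < p) (hr : 0 < r) :
    m * s ^ ((m + 1) / 2) * r ^ m * k ^ (-(m - 1) / 2) * p ^ (-(m + 1)) *
        (m * Real.sqrt (k * s) * r / p) ^ (m - 1) =
      s ^ m * m ^ m * (r ^ (2 * m - 1) / p ^ (2 * m)) := by
  refine Real.log_injOn_pos (mem_Ioi.mpr (by positivity)) (mem_Ioi.mpr (by positivity)) ?_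
  simp (disch := positivity) only [Real.log_mul, Real.log_div,
    Real.log_rpow, Real.log_sqrt]
  ring

/-- Table III: the single shadowed κ-μ Type I (Nakagami-m dominant shadowing)
PDF converges pointwise to the κ-μ PDF as the shadowing parameter m_d → ∞. -/
theorem single_shadowed_typeI_limit_kappa_mu
    (κ μ rhat r : ℝ)
    (hκ : 0 < κ) (hμ : 0 < μ) (hrhat : 0 < rhat) (hr : 0 < r) :
    Filter.Tendsto
      (fun md : ℝ =>
        (2 * md ^ md * (1 + κ) ^ μ * μ ^ μ / (Real.Gamma μ * (md + κ * μ) ^ md)) *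
          (r ^ (2 * μ - 1) / rhat ^ (2 * μ)) *
          Real.exp (-(r ^ 2) * (1 + κ) * μ / rhat ^ 2) *
          hyp1F1 md μ (μ ^ 2 * κ * (1 + κ) * r ^ 2 / (rhat ^ 2 * (md + κ * μ))))
      Filter.atTop
      (nhds (2 * μ * (1 + κ) ^ ((μ + 1) / 2) * r ^ μ * κ ^ (-(μ - 1) / 2) *
        Real.exp (-(κ * μ)) * rhat ^ (-(μ + 1)) *
        Real.exp (-μ * (1 + κ) * r ^ 2 / rhat ^ 2) *
        besselI (μ - 1) (2 * μ * Real.sqrt (κ * (1 + κ)) * r / rhat))) := by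
  set y := (μ * Real.sqrt (κ * (1 + κ)) * r / rhat) ^ 2 with hy
  have hs : 0 < 1 + κ := by positivity
  have hy' : y = μ ^ 2 * κ * (1 + κ) * r ^ 2 / rhat ^ 2 := by
    rw [hy, div_pow, mul_pow, mul_pow, Real.sq_sqrt (by positivity)]
    ring
  have hI : besselI (μ - 1) (2 * μ * Real.sqrt (κ * (1 + κ)) * r / rhat) =
      (μ * Real.sqrt (κ * (1 + κ)) * r / rhat) ^ (μ - 1) / Real.Gamma μ *
        ∑' n : ℕ, y ^ n / (poch μ n * n.factorial) := by
    have hx : 2 * μ * Real.sqrt (κ * (1 + κ)) * r / rhat / 2 =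
        μ * Real.sqrt (κ * (1 + κ)) * r / rhat := by ring
    rw [besselI_eq_rpow_mul_tsum (by linarith) (by positivity), hx, sub_add_cancel]
  have hlim := (((tendsto_rpow_div_add_rpow (κ * μ)).mul_const
    (2 * ((1 + κ) ^ μ * μ ^ μ * (r ^ (2 * μ - 1) / rhat ^ (2 * μ))) / Real.Gamma μ *
      Real.exp (-μ * (1 + κ) * r ^ 2 / rhat ^ 2))).mul
    (tendsto_hyp1F1_div_add hμ (by positivity : 0 ≤ κ * μ) y))
  rw [hI]
  convert hlim using 2 with md
  · rw [hy', div_div, show -(r ^ 2) * (1 + κ) * μ = -μ * (1 + κ) * r ^ 2 by ring]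
    ring
  · rw [← kappa_mu_coefficient_eq hκ hs hμ hrhat hr]
    ring
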